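/- For every point x of the projective limit Σ∞ and every m : ℕ, the decomposition measures ν_n^m converge weakly, as n → ∞, to a Borel probability measure ν on stdSimplex ℝ (V m); moreover ν is concentrated on the set Ω_m = ⋂_{n ≥ m} (π[n,m] '' stdSimplex ℝ (V n)) (that is, ν(Ω_m) = 1), and ν has barycenter x m, i.e., for every u : V m, ∫ y, y u ∂ν = (x m) u. -/

import Mathlib

open scoped BigOperators
open Filter Topology MeasureTheory

/-- The one-step affine projection induced by the cotransition probabilities `lam`:
`(π n x) u = ∑ v, lam n v u * x v`. -/
def projStep (V : ℕ → Type) [∀ n, Fintype (V n)]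
    (lam : ∀ n, V (n + 1) → V n → ℝ) (n : ℕ) (x : V (n + 1) → ℝ) : V n → ℝ :=
  fun u => ∑ v, lam n v u * x v

/-- The iterated projection `π[n,m] = π m ∘ ⋯ ∘ π (n-1)` for `m ≤ n` (with `π[n,n] = id`). -/
def projIter (V : ℕ → Type) [∀ n, Fintype (V n)]
    (lam : ∀ n, V (n + 1) → V n → ℝ) {m n : ℕ} (h : m ≤ n) :
    (V n → ℝ) → V m → ℝ :=
  Nat.leRecOn (C := fun k => (V k → ℝ) → V m → ℝ) h
    (fun {k} f x => f (projStep V lam k x)) id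

/-- The projective limit `Σ∞`. -/
def SigmaInf (V : ℕ → Type) [∀ n, Fintype (V n)]
    (lam : ∀ n, V (n + 1) → V n → ℝ) : Set (∀ n, V n → ℝ) :=
  {x | (∀ n, x n ∈ stdSimplex ℝ (V n)) ∧ ∀ n, projStep V lam n (x (n + 1)) = x n}

/-- The vertex `e v` of the simplex `stdSimplex ℝ (V n)`: the indicator function of `v`. -/
def vert (V : ℕ → Type) [∀ n, DecidableEq (V n)] {n : ℕ} (v : V n) : V n → ℝ :=
  fun u => if u = v then 1 else 0

theorem projIter_self (V : ℕ → Type) [∀ n, Fintype (V n)]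
    (lam : ∀ n, V (n + 1) → V n → ℝ) (m : ℕ) (z : V m → ℝ) :
    projIter V lam (le_refl m) z = z := by
  unfold projIter
  rw [Nat.leRecOn_self]; rfl

theorem projIter_succ (V : ℕ → Type) [∀ n, Fintype (V n)]
    (lam : ∀ n, V (n + 1) → V n → ℝ) {m n : ℕ} (h : m ≤ n) (h' : m ≤ n + 1)
    (z : V (n + 1) → ℝ) :
    projIter V lam h' z = projIter V lam h (projStep V lam n z) := by
  unfold projIter
  rw [Nat.leRecOn_succ h]

theorem projIter_trans (V : ℕ → Type) [∀ n, Fintype (V n)]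
    (lam : ∀ n, V (n + 1) → V n → ℝ) {m n : ℕ} (h : m ≤ n) {k : ℕ} (h' : n ≤ k)
    (z : V k → ℝ) :
    projIter V lam (h.trans h') z = projIter V lam h (projIter V lam h' z) := by
  induction k, h' using Nat.le_induction with
  | base => rw [projIter_self]
  | succ k hk ih => rw [projIter_succ V lam (h.trans hk), projIter_succ V lam hk, ih]

theorem projStep_mem (V : ℕ → Type) [∀ n, Fintype (V n)]
    (lam : ∀ n, V (n + 1) → V n → ℝ)
    (hpos : ∀ n (v : V (n + 1)) (u : V n), 0 ≤ lam n v u)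
    (hsum : ∀ n (v : V (n + 1)), ∑ u, lam n v u = 1) (n : ℕ) (z : V (n + 1) → ℝ)
    (hz : z ∈ stdSimplex ℝ (V (n + 1))) : projStep V lam n z ∈ stdSimplex ℝ (V n) := by
  refine ⟨fun u => Finset.sum_nonneg fun v _ => mul_nonneg (hpos n v u) (hz.1 v), ?_⟩
  simp only [projStep]
  rw [Finset.sum_comm]
  simp only [← Finset.sum_mul, hsum, one_mul]
  exact hz.2

theorem projIter_mem (V : ℕ → Type) [∀ n, Fintype (V n)]
    (lam : ∀ n, V (n + 1) → V n → ℝ)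
    (hpos : ∀ n (v : V (n + 1)) (u : V n), 0 ≤ lam n v u)
    (hsum : ∀ n (v : V (n + 1)), ∑ u, lam n v u = 1) {m n : ℕ} (h : m ≤ n) (z : V n → ℝ)
    (hz : z ∈ stdSimplex ℝ (V n)) : projIter V lam h z ∈ stdSimplex ℝ (V m) := by
  induction n, h using Nat.le_induction with
  | base => rwa [projIter_self]
  | succ k hk ih =>
    rw [projIter_succ V lam hk]
    exact ih _ (projStep_mem V lam hpos hsum k z hz)

theorem projIter_x (V : ℕ → Type) [∀ n, Fintype (V n)]
    (lam : ∀ n, V (n + 1) → V n → ℝ)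
    (x : ∀ n, V n → ℝ) (hx : x ∈ SigmaInf V lam) {m n : ℕ} (h : m ≤ n) :
    projIter V lam h (x n) = x m := by
  induction n, h using Nat.le_induction with
  | base => rw [projIter_self]
  | succ k hk ih => rw [projIter_succ V lam hk, hx.2, ih]

theorem vert_mem (V : ℕ → Type) [∀ n, Fintype (V n)] [∀ n, DecidableEq (V n)] {n : ℕ}
    (v : V n) : vert V v ∈ stdSimplex ℝ (V n) := by
  refine ⟨fun u => ?_, ?_⟩
  · unfold vert; split_ifs <;> norm_num
  · simp [vert]

/-- `projIter` is given by a matrix. -/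
theorem projIter_linear (V : ℕ → Type) [∀ n, Fintype (V n)] [∀ n, DecidableEq (V n)]
    (lam : ∀ n, V (n + 1) → V n → ℝ) {m n : ℕ} (h : m ≤ n) :
    ∃ A : (V n → ℝ) →ₗ[ℝ] (V m → ℝ), ∀ z, projIter V lam h z = A z := by
  induction n, h using Nat.le_induction with
  | base => exact ⟨LinearMap.id, fun z => by rw [projIter_self]; rfl⟩
  | succ k hk ih =>
    obtain ⟨A, hA⟩ := ih
    refine ⟨A ∘ₗ { toFun := projStep V lam k, map_add' := ?_, map_smul' := ?_ }, fun z => ?_⟩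
    · intro a b
      ext u
      simp [projStep, mul_add, Finset.sum_add_distrib]
    · intro a b
      ext u
      simp only [projStep, Pi.smul_apply, smul_eq_mul, Finset.mul_sum, RingHom.id_apply]
      exact Finset.sum_congr rfl fun _ _ => by ring
    · rw [projIter_succ V lam hk, hA]; rfl

theorem projIter_apply (V : ℕ → Type) [∀ n, Fintype (V n)] [∀ n, DecidableEq (V n)]
    (lam : ∀ n, V (n + 1) → V n → ℝ) {m n : ℕ} (h : m ≤ n) (z : V n → ℝ) (w : V m) :
    projIter V lam h z w = ∑ v, z v * projIter V lam h (vert V v) w := by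
  obtain ⟨A, hA⟩ := projIter_linear V lam h
  simp only [hA]
  have : z = ∑ v, z v • vert V v := by
    ext u
    simp [vert]
  conv_lhs => rw [this]
  simp

theorem coupling {U W ι : Type} [Fintype U] [Fintype W] [Fintype ι]
    (p : U → ℝ) (q : W → ℝ) (P : W → U → ℝ) (hq : ∀ v, 0 ≤ q v) (hq1 : ∑ v, q v = 1)
    (hP : ∀ v u, 0 ≤ P v u)
    (hP1 : ∀ v, ∑ u, P v u = 1) (hp : ∀ u, p u = ∑ v, q v * P v u)
    (y : U → ι → ℝ) (z : W → ι → ℝ) (hz : ∀ v i, z v i = ∑ u, P v u * y u i)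
    (f : (ι → ℝ) → ℝ) (ε C : ℝ)
    (hf : ∀ u v, |f (y u) - f (z v)| ≤ ε + C * ∑ i, (y u i - z v i) ^ 2) :
    |∑ u, p u * f (y u) - ∑ v, q v * f (z v)| ≤
      ε + C * (∑ u, p u * ∑ i, y u i ^ 2 - ∑ v, q v * ∑ i, z v i ^ 2) := by
  have key : ∀ g : (ι → ℝ) → ℝ, ∑ u, p u * g (y u) - ∑ v, q v * g (z v)
      = ∑ v, q v * ∑ u, P v u * (g (y u) - g (z v)) := by
    intro g
    simp only [mul_sub, Finset.sum_sub_distrib, ← Finset.sum_mul, hP1, one_mul, hp]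
    congr 1
    simp only [Finset.mul_sum, Finset.sum_mul]
    rw [Finset.sum_comm]
    exact Finset.sum_congr rfl fun _ _ => Finset.sum_congr rfl fun _ _ => by ring
  have var : ∀ v, ∑ u, P v u * ((∑ i, y u i ^ 2) - ∑ i, z v i ^ 2)
      = ∑ u, P v u * ∑ i, (y u i - z v i) ^ 2 := by
    intro v
    have h1 : ∀ i, ∑ u, P v u * (y u i ^ 2 - z v i ^ 2) = ∑ u, P v u * (y u i - z v i) ^ 2 := by
      intro i
      have e : ∀ u, P v u * (y u i - z v i) ^ 2 = P v u * (y u i ^ 2 - z v i ^ 2)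
          - 2 * z v i * (P v u * y u i) + 2 * z v i ^ 2 * P v u := fun u => by ring
      simp only [e, Finset.sum_add_distrib, Finset.sum_sub_distrib, ← Finset.mul_sum, hP1, ← hz]
      ring
    simp only [← Finset.sum_sub_distrib, Finset.mul_sum]
    rw [Finset.sum_comm, Finset.sum_comm (γ := U)]
    exact Finset.sum_congr rfl fun i _ => h1 i
  rw [key f, key (fun y => ∑ i, y i ^ 2)]
  simp only [var]
  calc |∑ v, q v * ∑ u, P v u * (f (y u) - f (z v))|
      ≤ ∑ v, q v * ∑ u, P v u * (ε + C * ∑ i, (y u i - z v i) ^ 2) := by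
        refine (Finset.abs_sum_le_sum_abs _ _).trans (Finset.sum_le_sum fun v _ => ?_)
        rw [abs_mul, abs_of_nonneg (hq v)]
        refine mul_le_mul_of_nonneg_left ?_ (hq v)
        refine (Finset.abs_sum_le_sum_abs _ _).trans (Finset.sum_le_sum fun u _ => ?_)
        rw [abs_mul, abs_of_nonneg (hP v u)]
        exact mul_le_mul_of_nonneg_left (hf u v) (hP v u)
    _ = _ := by
        simp only [mul_add, Finset.sum_add_distrib, ← Finset.sum_mul, hP1, hq1, one_mul]
        congr 1
        simp only [Finset.mul_sum]
        exact Finset.sum_congr rfl fun _ _ => Finset.sum_congr rfl fun _ _ =>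
          Finset.sum_congr rfl fun _ _ => by ring

theorem quad_bound {ι : Type} [Fintype ι] (K : Set (ι → ℝ)) (hK : IsCompact K)
    (f : (ι → ℝ) → ℝ) (hf : Continuous f) (ε : ℝ) (hε : 0 < ε) :
    ∃ C : ℝ, 0 ≤ C ∧ ∀ a ∈ K, ∀ b ∈ K, |f a - f b| ≤ ε + C * ∑ i, (a i - b i) ^ 2 := by
  have huc := hK.uniformContinuousOn_of_continuous hf.continuousOn
  obtain ⟨δ, hδ, h⟩ := Metric.uniformContinuousOn_iff.1 huc ε hε
  obtain ⟨M, hM⟩ := hK.exists_bound_of_continuousOn hf.continuousOn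
  refine ⟨2 * |M| / δ ^ 2, by positivity, fun a ha b hb => ?_⟩
  have hs : 0 ≤ ∑ i, (a i - b i) ^ 2 := Finset.sum_nonneg fun _ _ => sq_nonneg _
  by_cases hd : dist a b < δ
  · have := (h a ha b hb hd).le
    rw [Real.dist_eq] at this
    have : 0 ≤ 2 * |M| / δ ^ 2 * ∑ i, (a i - b i) ^ 2 := by positivity
    linarith
  · have h1 : δ ^ 2 ≤ ∑ i, (a i - b i) ^ 2 := by
      rw [dist_pi_lt_iff hδ] at hd
      push Not at hd
      obtain ⟨i, hi⟩ := hd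
      rw [Real.dist_eq] at hi
      calc δ ^ 2 ≤ |a i - b i| ^ 2 := by gcongr
        _ = (a i - b i) ^ 2 := sq_abs _
        _ ≤ _ := Finset.single_le_sum (f := fun i => (a i - b i) ^ 2)
          (fun _ _ => sq_nonneg _) (Finset.mem_univ i)
    have h2 : 2 * |M| ≤ 2 * |M| / δ ^ 2 * ∑ i, (a i - b i) ^ 2 := by
      rw [div_mul_eq_mul_div, le_div_iff₀ (by positivity)]
      gcongr
    have h3 := hM a ha
    have h4 := hM b hb
    rw [Real.norm_eq_abs] at h3 h4
    have := abs_sub (f a) (f b)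
    have := le_abs_self M
    linarith

theorem exists_limit {ι : Type} [Fintype ι] (K : Set (ι → ℝ)) (hK : IsCompact K)
    (W : ℕ → Type) [∀ n, Fintype (W n)] (w : ∀ n, W n → ℝ) (hw : ∀ n v, 0 ≤ w n v)
    (hw1 : ∀ n, ∑ v, w n v = 1) (y : ∀ n, W n → ι → ℝ) (hy : ∀ n v, y n v ∈ K)
    (hc : ∀ f : (ι → ℝ) → ℝ, Continuous f → CauchySeq fun n => ∑ v, w n v * f (y n v)) :
    ∃ ν : Measure (ι → ℝ), IsProbabilityMeasure ν ∧ ∀ f : (ι → ℝ) → ℝ, Continuous f →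
      Integrable f ν ∧ Tendsto (fun n => ∑ v, w n v * f (y n v)) atTop (𝓝 (∫ y, f y ∂ν)) := by
  have : CompactSpace K := isCompact_iff_compactSpace.1 hK
  let μ : ℕ → ProbabilityMeasure K := fun n =>
    ⟨∑ v, ENNReal.ofReal (w n v) • Measure.dirac (⟨y n v, hy n v⟩ : K), ⟨by
      simp only [Measure.coe_finsetSum, Finset.sum_apply, Measure.smul_apply, measure_univ,
        smul_eq_mul, mul_one]
      rw [← ENNReal.ofReal_sum_of_nonneg fun v _ => hw n v, hw1, ENNReal.ofReal_one]⟩⟩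
  have hμ : ∀ n (g : K → ℝ), Continuous g → ∫ k, g k ∂(μ n : Measure K)
      = ∑ v, w n v * g ⟨y n v, hy n v⟩ := by
    intro n g hg
    change ∫ k, g k ∂(∑ v, ENNReal.ofReal (w n v) • Measure.dirac (⟨y n v, hy n v⟩ : K)) = _
    rw [integral_finsetSum_measure]
    · refine Finset.sum_congr rfl fun v _ => ?_
      rw [integral_smul_measure, integral_dirac, ENNReal.toReal_ofReal (hw n v), smul_eq_mul]
    · intro v _
      exact (integrable_dirac (by simp)).smul_measure ENNReal.ofReal_ne_top
  let F : Ultrafilter ℕ := hyperfilter ℕ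
  have hF : (F : Filter ℕ) ≤ atTop := by
    rw [← Nat.cofinite_eq_atTop]; exact hyperfilter_le_cofinite
  obtain ⟨ν, -, hν⟩ := isCompact_univ.ultrafilter_le_nhds (F.map μ) (by simp)
  have hT : Tendsto μ F (𝓝 ν) := hν
  rw [ProbabilityMeasure.tendsto_iff_forall_integral_tendsto] at hT
  refine ⟨(ν : Measure K).map Subtype.val,
    Measure.isProbabilityMeasure_map measurable_subtype_coe.aemeasurable, fun f hf => ⟨?_, ?_⟩⟩
  · rw [integrable_map_measure hf.aestronglyMeasurable measurable_subtype_coe.aemeasurable]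
    exact (BoundedContinuousFunction.mkOfCompact
      ⟨fun k : K => f k, hf.comp continuous_subtype_val⟩).integrable _
  · rw [integral_map measurable_subtype_coe.aemeasurable hf.aestronglyMeasurable]
    obtain ⟨l, hl⟩ := cauchySeq_tendsto_of_complete (hc f hf)
    have h1 := hT (BoundedContinuousFunction.mkOfCompact
      ⟨fun k : K => f k, hf.comp continuous_subtype_val⟩)
    simp only [BoundedContinuousFunction.mkOfCompact_apply, ContinuousMap.coe_mk] at h1
    simp only [fun n => hμ n (fun k : K => f k) (hf.comp continuous_subtype_val)] at h1
    rw [tendsto_nhds_unique h1 (hl.mono_left hF)]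
    exact hl

/-- for every `x ∈ Σ∞` and every `m`, the decomposition measures
`ν_n^m = ∑_v (x n) v • δ_{π[n,m](e v)}` converge weakly, as `n → ∞`, to a Borel probability
measure `ν` which is concentrated on `Ω_m = ⋂_{n ≥ m} π[n,m] '' stdSimplex ℝ (V n)` and has
barycenter `x m`. -/
theorem decomposition_measures_converge
    (V : ℕ → Type) [∀ n, Fintype (V n)] [∀ n, Nonempty (V n)] [∀ n, DecidableEq (V n)]
    (lam : ∀ n, V (n + 1) → V n → ℝ)
    (hpos : ∀ n (v : V (n + 1)) (u : V n), 0 ≤ lam n v u)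
    (hsum : ∀ n (v : V (n + 1)), ∑ u, lam n v u = 1)
    (x : ∀ n, V n → ℝ) (hx : x ∈ SigmaInf V lam) (m : ℕ) :
    ∃ ν : Measure (V m → ℝ), IsProbabilityMeasure ν ∧
      (∀ f : (V m → ℝ) → ℝ, Continuous f →
        Tendsto
          (fun n : ℕ =>
            if h : m ≤ n then ∑ v : V n, x n v * f (projIter V lam h (vert V v)) else 0)
          atTop (𝓝 (∫ y, f y ∂ν))) ∧
      ν (⋂ (n : ℕ), ⋂ (h : m ≤ n), projIter V lam h '' stdSimplex ℝ (V n)) = 1 ∧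
      ∀ u : V m, (∫ y, y u ∂ν) = x m u := by
  obtain ⟨hxs, hxp⟩ := id hx
  have hK := isCompact_stdSimplex ℝ (V m)
  have hy : ∀ k (v : V (m + k)), projIter V lam (Nat.le_add_right m k) (vert V v) ∈
      stdSimplex ℝ (V m) := fun k v => projIter_mem V lam hpos hsum _ _ (vert_mem V v)
  have hcp : ∀ (f : (V m → ℝ) → ℝ) (ε C : ℝ), (∀ a ∈ stdSimplex ℝ (V m),
      ∀ b ∈ stdSimplex ℝ (V m), |f a - f b| ≤ ε + C * ∑ i, (a i - b i) ^ 2) →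
      ∀ j k, j ≤ k →
      |∑ u, x (m + j) u * f (projIter V lam (Nat.le_add_right m j) (vert V u))
        - ∑ v, x (m + k) v * f (projIter V lam (Nat.le_add_right m k) (vert V v))| ≤
      ε + C * (∑ u, x (m + j) u * ∑ i, projIter V lam (Nat.le_add_right m j) (vert V u) i ^ 2
        - ∑ v, x (m + k) v * ∑ i, projIter V lam (Nat.le_add_right m k) (vert V v) i ^ 2) := by
    intro f ε C hf j k hjk
    have hjk' : m + j ≤ m + k := by omega
    refine coupling (x (m + j)) (x (m + k)) (fun v => projIter V lam hjk' (vert V v))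
      (hxs _).1 (hxs _).2 (fun v => (projIter_mem V lam hpos hsum hjk' _ (vert_mem V v)).1)
      (fun v => (projIter_mem V lam hpos hsum hjk' _ (vert_mem V v)).2) ?_ _ _ ?_ f ε C
      (fun u v => hf _ (hy _ _) _ (hy _ _))
    · intro u
      rw [← projIter_apply, projIter_x V lam x hx]
    · intro v i
      rw [← projIter_apply V lam (Nat.le_add_right m j), ← projIter_trans]
  have hanti : Antitone fun k => ∑ u, x (m + k) u *
      ∑ i, projIter V lam (Nat.le_add_right m k) (vert V u) i ^ 2 := by
    intro j k hjk
    have := (abs_nonneg _).trans (hcp (fun _ => 0) 0 1 (fun a _ b _ => by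
      simp only [sub_self, abs_zero, zero_add, one_mul]
      exact Finset.sum_nonneg fun _ _ => sq_nonneg _) j k hjk)
    simp only
    linarith
  have hbdd : BddBelow (Set.range fun k => ∑ u, x (m + k) u *
      ∑ i, projIter V lam (Nat.le_add_right m k) (vert V u) i ^ 2) := by
    refine ⟨0, ?_⟩
    rintro _ ⟨k, rfl⟩
    exact Finset.sum_nonneg fun u _ => mul_nonneg ((hxs _).1 u)
      (Finset.sum_nonneg fun _ _ => sq_nonneg _)
  have hNc := (tendsto_atTop_ciInf hanti hbdd).cauchySeq
  have hc : ∀ f : (V m → ℝ) → ℝ, Continuous f → CauchySeq fun k => ∑ v : V (m + k),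
      x (m + k) v * f (projIter V lam (Nat.le_add_right m k) (vert V v)) := by
    intro f hf
    rw [Metric.cauchySeq_iff']
    intro ε hε
    obtain ⟨C, hC0, hC⟩ := quad_bound _ hK f hf (ε / 2) (by positivity)
    obtain ⟨N, hN⟩ := Metric.cauchySeq_iff'.1 hNc (ε / (2 * (C + 1))) (by positivity)
    refine ⟨N, fun k hk => ?_⟩
    have h1 := hcp f _ C hC N k hk
    have h2 := hN k hk
    rw [dist_comm, Real.dist_eq] at h2 ⊢
    refine h1.trans_lt ?_
    have h3 := (le_abs_self _).trans h2.le
    have h4 := mul_le_mul_of_nonneg_left h3 hC0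
    have h5 : C * (ε / (2 * (C + 1))) < ε / 2 := by
      rw [mul_div_assoc', div_lt_div_iff₀ (by positivity) (by positivity)]
      nlinarith
    linarith
  obtain ⟨ν, hν, hlim⟩ := exists_limit (stdSimplex ℝ (V m)) hK (fun k => V (m + k))
    (fun k => x (m + k)) (fun k => (hxs _).1) (fun k => (hxs _).2)
    (fun k v => projIter V lam (Nat.le_add_right m k) (vert V v)) hy hc
  refine ⟨ν, hν, ?_, ?_, ?_⟩
  · intro f hf
    have h1 := (hlim f hf).2
    rw [← tendsto_add_atTop_iff_nat m]
    refine h1.congr fun k => ?_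
    rw [Nat.add_comm k m, dif_pos (Nat.le_add_right m k)]
  · have hae : ∀ n, ∀ h : m ≤ n, ∀ᵐ y ∂ν, y ∈ projIter V lam h '' stdSimplex ℝ (V n) := by
      intro n h
      set S := projIter V lam h '' stdSimplex ℝ (V n) with hS
      have hSc : IsClosed S := by
        obtain ⟨A, hA⟩ := projIter_linear V lam h
        have : projIter V lam h = A := funext hA
        rw [hS, this]
        exact ((isCompact_stdSimplex ℝ (V n)).image A.continuous_of_finiteDimensional).isClosed
      have hSn : S.Nonempty := ⟨_, Set.mem_image_of_mem _ (hxs n)⟩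
      have hcont : Continuous fun y => Metric.infDist y S := Metric.continuous_infDist_pt S
      obtain ⟨hInt, ht⟩ := hlim _ hcont
      have h0 : ∫ y, Metric.infDist y S ∂ν = 0 := by
        refine tendsto_nhds_unique ht (tendsto_const_nhds.congr' ?_)
        filter_upwards [eventually_ge_atTop n] with k hk
        refine (Finset.sum_eq_zero fun v _ => ?_).symm
        have hnk : n ≤ m + k := by omega
        rw [Metric.infDist_zero_of_mem, mul_zero]
        rw [show projIter V lam (Nat.le_add_right m k) (vert V v)
          = projIter V lam h (projIter V lam hnk (vert V v)) from projIter_trans V lam h hnk _]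
        exact Set.mem_image_of_mem _ (projIter_mem V lam hpos hsum hnk _ (vert_mem V v))
      rw [integral_eq_zero_iff_of_nonneg (fun y => Metric.infDist_nonneg) hInt] at h0
      filter_upwards [h0] with y hy0
      exact (hSc.mem_iff_infDist_zero hSn).2 hy0
    have : ∀ᵐ y ∂ν, y ∈ ⋂ (n : ℕ), ⋂ (h : m ≤ n), projIter V lam h '' stdSimplex ℝ (V n) := by
      simp only [Set.mem_iInter]
      exact ae_all_iff.2 fun n => ae_all_iff.2 fun h => hae n h
    exact (measure_congr (eventuallyEq_univ.2 this)).trans measure_univ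
  · intro u
    refine tendsto_nhds_unique (hlim (fun y => y u) (continuous_apply u)).2
      (tendsto_const_nhds.congr fun k => ?_)
    rw [← projIter_apply, projIter_x V lam x hx]
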